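/- arXiv:math/0409306 — 4 statements merged into one kernel-verified Lean document; each statement's English description precedes it below -/
import Mathlib

section
/- Let A be a complex unital Banach algebra, let a ≤ b be real numbers, and let α : [a,b] → A be continuous. Then the function E : [a,b] → A defined by E(t) = Te^{∫_a^t α(s)ds} is the unique differentiable function satisfying E(a) = 1 and E'(t) = E(t)·α(t) for all t ∈ [a,b]. -/
open MeasureTheory
noncomputable section

/-- The ordered simplex `{a ≤ s 0 ≤ s 1 ≤ ⋯ ≤ s (n-1) ≤ b}`. -/
def orderedSimplex (n : ℕ) (a b : ℝ) : Set (Fin n → ℝ) :=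
  {s | (∀ i, s i ∈ Set.Icc a b) ∧ Monotone s}

/-- The time-ordered exponential (expansional)
`Te^{∫_a^b α(s)ds} = 1 + Σ_{n≥1} ∫_{a≤s_1≤⋯≤s_n≤b} α(s_1)⋯α(s_n) ds`. -/
def Texp {A : Type*} [NormedRing A] [NormedAlgebra ℂ A] [CompleteSpace A]
    (α : ℝ → A) (a b : ℝ) : A :=
  ∑' n : ℕ, ∫ s in orderedSimplex n a b, (List.ofFn fun i => α (s i)).prod

theorem isCompact_orderedSimplex (n : ℕ) (a b : ℝ) : IsCompact (orderedSimplex n a b) := by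
  have h : orderedSimplex n a b = (Set.univ.pi fun _ => Set.Icc a b) ∩ {s | Monotone s} := by
    ext s
    simp only [orderedSimplex, Set.mem_ofPred_eq, Set.mem_inter_iff, Set.mem_univ_pi]
  rw [h]
  exact (isCompact_univ_pi fun _ => isCompact_Icc).inter_right isClosed_monotone

theorem snoc_mem_orderedSimplex {n : ℕ} {a b x : ℝ} {s : Fin n → ℝ} :
    (Fin.snoc s x : Fin (n + 1) → ℝ) ∈ orderedSimplex (n + 1) a b ↔
      x ∈ Set.Icc a b ∧ s ∈ orderedSimplex n a x := by
  simp only [orderedSimplex, Set.mem_ofPred_eq, Fin.forall_fin_succ', Fin.snoc_castSucc,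
    Fin.snoc_last, Set.mem_Icc]
  constructor
  · rintro ⟨⟨hs, hx⟩, hm⟩
    refine ⟨hx, fun i => ⟨(hs i).1, ?_⟩, fun i j hij => ?_⟩
    · simpa using hm (Fin.le_last i.castSucc)
    · simpa using hm (Fin.castSucc_le_castSucc_iff.2 hij)
  · rintro ⟨hx, hs, hm⟩
    refine ⟨⟨fun i => ⟨(hs i).1, (hs i).2.trans hx.2⟩, hx⟩, fun i j => ?_⟩
    induction i using Fin.lastCases with
    | last =>
      induction j using Fin.lastCases with
      | last => simp
      | cast j => simp
    | cast i =>
      induction j using Fin.lastCases with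
      | last => simpa using fun _ => (hs i).2
      | cast j => simpa using @hm i j

theorem continuous_prod_ofFn {A : Type*} [NormedRing A] {α : ℝ → A} (hα : Continuous α) (n : ℕ) :
    Continuous fun s : Fin n → ℝ => (List.ofFn fun i => α (s i)).prod := by
  simp_rw [List.ofFn_eq_map]
  exact continuous_list_prod _ fun i _ => hα.comp (continuous_apply i)

section

variable {A : Type*} [NormedRing A] [NormedAlgebra ℂ A]

/-- The iterated integrals `1, ∫_a^t α, ∫_a^t (∫_a^s α) α(s) ds, …`. -/
def dysonTerm (α : ℝ → A) (a : ℝ) : ℕ → ℝ → A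
  | 0 => fun _ => 1
  | n + 1 => fun t => ∫ s in a..t, dysonTerm α a n s * α s

theorem continuous_dysonTerm {α : ℝ → A} (hα : Continuous α) (a : ℝ) (n : ℕ) :
    Continuous (dysonTerm α a n) := by
  induction n with
  | zero => exact continuous_const
  | succ n ih =>
    exact intervalIntegral.continuous_primitive
      (fun _ _ => (ih.mul hα).intervalIntegrable _ _) a

theorem hasDerivAt_dysonTerm_succ [CompleteSpace A] {α : ℝ → A} (hα : Continuous α) (a : ℝ)
    (n : ℕ) (t : ℝ) :
    HasDerivAt (dysonTerm α a (n + 1)) (dysonTerm α a n t * α t) t :=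
  ((continuous_dysonTerm hα a n).mul hα).integral_hasStrictDerivAt a t |>.hasDerivAt

theorem norm_dysonTerm_le [NormOneClass A] {α : ℝ → A} {M : ℝ} (hM : ∀ t, ‖α t‖ ≤ M)
    (a : ℝ) (n : ℕ) (t : ℝ) :
    ‖dysonTerm α a n t‖ ≤ (M * |t - a|) ^ n / n.factorial := by
  have hM0 : 0 ≤ M := (norm_nonneg _).trans (hM a)
  induction n generalizing t with
  | zero => simp [dysonTerm]
  | succ n ih =>
    have hcont : Continuous fun s : ℝ => M ^ (n + 1) / n.factorial * |s - a| ^ n := by fun_prop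
    calc ‖dysonTerm α a (n + 1) t‖
        = ‖∫ s in Set.uIoc a t, dysonTerm α a n s * α s‖ :=
          intervalIntegral.norm_integral_eq_norm_integral_uIoc _
      _ ≤ ∫ s in Set.uIoc a t, M ^ (n + 1) / n.factorial * |s - a| ^ n := by
          refine norm_integral_le_of_norm_le
            (intervalIntegrable_iff.1 (hcont.intervalIntegrable a t)) (.of_forall fun s => ?_)
          calc ‖dysonTerm α a n s * α s‖ ≤ (M * |s - a|) ^ n / n.factorial * M :=
                (norm_mul_le _ _).trans (mul_le_mul (ih s) (hM s) (norm_nonneg _) (by positivity))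
            _ = M ^ (n + 1) / n.factorial * |s - a| ^ n := by ring
      _ = (M * |t - a|) ^ (n + 1) / (n + 1).factorial := by
          rw [integral_const_mul, integral_pow_abs_sub_uIoc, Nat.factorial_succ]
          push_cast
          rw [mul_pow]
          field_simp

theorem setIntegral_orderedSimplex_succ {α : ℝ → A} (hα : Continuous α) {a t : ℝ} (hat : a ≤ t)
    (n : ℕ) :
    ∫ s in orderedSimplex (n + 1) a t, (List.ofFn fun i => α (s i)).prod =
      ∫ x in a..t, (∫ s in orderedSimplex n a x, (List.ofFn fun i => α (s i)).prod) * α x := by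
  have he := (volume_preserving_piFinSuccAbove (fun _ : Fin (n + 1) => ℝ) (Fin.last n)).symm
  set f : (Fin (n + 1) → ℝ) → A := (orderedSimplex (n + 1) a t).indicator
    fun s => (List.ofFn fun i => α (s i)).prod with hf
  have hmeas (m : ℕ) (u : ℝ) : MeasurableSet (orderedSimplex m a u) :=
    (isCompact_orderedSimplex m a u).measurableSet
  have hfi : Integrable f :=
    ((continuous_prod_ofFn hα _).continuousOn.integrableOn_compact
      (isCompact_orderedSimplex _ a t)).integrable_indicator (hmeas _ t)
  have hfs (x : ℝ) (s : Fin n → ℝ) : f (Fin.snoc s x) = (Set.Icc a t).indicator (fun x =>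
      (orderedSimplex n a x).indicator
        (fun s => (List.ofFn fun i => α (s i)).prod * α x) s) x := by
    by_cases hx : x ∈ Set.Icc a t <;> by_cases hs : s ∈ orderedSimplex n a x <;>
      simp [hf, Set.indicator, snoc_mem_orderedSimplex, hx, hs, List.ofFn_succ',
        -List.ofFn_succ, -Set.mem_Icc]
  rw [← integral_indicator (hmeas _ t), ← he.integral_comp',
    intervalIntegral.integral_of_le hat, ← integral_Icc_eq_integral_Ioc,
    ← integral_indicator measurableSet_Icc]
  have hfi' := (he.integrable_comp_emb (MeasurableEquiv.measurableEmbedding _)).2 hfi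
  refine (integral_prod _ hfi').trans (integral_congr_ae (.of_forall fun x => ?_))
  simp only [MeasurableEquiv.piFinSuccAbove_symm_apply, Fin.insertNthEquiv_last]
  change ∫ s : Fin n → ℝ, f (Fin.snoc s x) = _
  simp_rw [hfs]
  by_cases hx : x ∈ Set.Icc a t
  · simp only [Set.indicator_of_mem hx]
    rw [integral_indicator (hmeas n x)]
    exact integral_mul_const_of_integrable
      ((continuous_prod_ofFn hα _).continuousOn.integrableOn_compact
        (isCompact_orderedSimplex _ a x))
  · simp [Set.indicator_of_notMem hx]

theorem setIntegral_orderedSimplex_eq_dysonTerm [CompleteSpace A] {α : ℝ → A} (hα : Continuous α)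
    {a t : ℝ} (hat : a ≤ t) (n : ℕ) :
    ∫ s in orderedSimplex n a t, (List.ofFn fun i => α (s i)).prod = dysonTerm α a n t := by
  induction n generalizing t with
  | zero =>
    have h : orderedSimplex 0 a t = Set.univ :=
      Set.eq_univ_of_forall fun s => ⟨fun i => i.elim0, fun i => i.elim0⟩
    simp [h, dysonTerm, Measure.real, volume_pi]
  | succ n ih =>
    rw [setIntegral_orderedSimplex_succ hα hat]
    refine intervalIntegral.integral_congr fun x hx => ?_
    rw [Set.uIcc_of_le hat] at hx
    simp only [ih hx.1]

theorem summable_dysonTerm [NormOneClass A] [CompleteSpace A] {α : ℝ → A} {M : ℝ}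
    (hM : ∀ t, ‖α t‖ ≤ M) (a t : ℝ) : Summable fun n => dysonTerm α a n t :=
  .of_norm_bounded (Real.summable_pow_div_factorial _) fun n => norm_dysonTerm_le hM a n t

theorem hasDerivAt_tsum_dysonTerm [NormOneClass A] [CompleteSpace A] {α : ℝ → A}
    (hα : Continuous α) {M : ℝ} (hM : ∀ t, ‖α t‖ ≤ M) (a t : ℝ) :
    HasDerivAt (fun u => ∑' n, dysonTerm α a n u) ((∑' n, dysonTerm α a n t) * α t) t := by
  have hM0 : 0 ≤ M := (norm_nonneg _).trans (hM a)
  have hsucc : HasDerivAt (fun u => ∑' n, dysonTerm α a (n + 1) u)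
      (∑' n, dysonTerm α a n t * α t) t := by
    have hmem : t ∈ Metric.ball a (|t - a| + 1) := by simp [Real.dist_eq]
    refine hasDerivAt_tsum_of_isPreconnected
      (u := fun n => (M * (|t - a| + 1)) ^ n / n.factorial * M)
      (g' := fun n y => dysonTerm α a n y * α y) (t := Metric.ball a (|t - a| + 1))
      ((Real.summable_pow_div_factorial _).mul_right M)
      Metric.isOpen_ball (convex_ball _ _).isPreconnected
      (fun n y _ => hasDerivAt_dysonTerm_succ hα a n y) (fun n y hy => ?_) hmem
      ((summable_nat_add_iff 1).2 (summable_dysonTerm hM a t)) hmem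
    have hy' : |y - a| ≤ |t - a| + 1 := (Metric.mem_ball.1 hy).le
    refine (norm_mul_le _ _).trans (mul_le_mul ?_ (hM y) (norm_nonneg _) (by positivity))
    exact (norm_dysonTerm_le hM a n y).trans (by gcongr)
  rw [← (summable_dysonTerm hM a t).tsum_mul_right]
  have hsplit : (fun u => ∑' n, dysonTerm α a n u) =
      fun u => 1 + ∑' n, dysonTerm α a (n + 1) u :=
    funext fun u => (summable_dysonTerm hM a u).tsum_eq_zero_add
  rw [hsplit]
  exact hsucc.const_add 1

theorem Texp_congr [CompleteSpace A] {α β : ℝ → A} {a b : ℝ}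
    (h : Set.EqOn α β (Set.Icc a b)) : Texp α a b = Texp β a b := by
  refine tsum_congr fun n => setIntegral_congr_fun
    (isCompact_orderedSimplex n a b).measurableSet fun s hs => ?_
  simp only [funext fun i => h (hs.1 i)]

theorem Texp_eq_tsum_dysonTerm [CompleteSpace A] {α : ℝ → A} (hα : Continuous α) {a t : ℝ}
    (hat : a ≤ t) : Texp α a t = ∑' n, dysonTerm α a n t :=
  tsum_congr fun n => setIntegral_orderedSimplex_eq_dysonTerm hα hat n

theorem eqOn_of_hasDerivWithinAt_mul {α : ℝ → A} {a b M : ℝ}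
    (hM : ∀ t ∈ Set.Icc a b, ‖α t‖ ≤ M) {F G : ℝ → A}
    (hF : ∀ t ∈ Set.Icc a b, HasDerivWithinAt F (F t * α t) (Set.Icc a b) t)
    (hG : ∀ t ∈ Set.Icc a b, HasDerivWithinAt G (G t * α t) (Set.Icc a b) t)
    (h : F a = G a) : Set.EqOn F G (Set.Icc a b) := by
  have hIci {H : ℝ → A} (hH : ∀ t ∈ Set.Icc a b,
      HasDerivWithinAt H (H t * α t) (Set.Icc a b) t) (t : ℝ) (ht : t ∈ Set.Ico a b) :
      HasDerivWithinAt H (H t * α t) (Set.Ici t) t :=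
    (hH t (Set.Ico_subset_Icc_self ht)).mono_of_mem_nhdsWithin (Icc_mem_nhdsGE_of_mem ht)
  refine ODE_solution_unique_of_mem_Icc_right (v := fun t x => x * α t) (K := M.toNNReal)
    (s := fun _ => Set.univ) (fun t ht => ?_)
    (fun t ht => (hF t ht).continuousWithinAt) (hIci hF) (fun _ _ => Set.mem_univ _)
    (fun t ht => (hG t ht).continuousWithinAt) (hIci hG) (fun _ _ => Set.mem_univ _) h
  refine LipschitzOnWith.of_dist_le_mul fun x _ y _ => ?_
  rw [dist_eq_norm, dist_eq_norm, ← sub_mul, mul_comm (M.toNNReal : ℝ)]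
  exact (norm_mul_le _ _).trans (mul_le_mul_of_nonneg_left
    ((hM t (Set.Ico_subset_Icc_self ht)).trans (Real.le_coe_toNNReal M)) (norm_nonneg _))

end

theorem stmt1 {A : Type*} [NormedRing A] [NormOneClass A] [NormedAlgebra ℂ A]
    [CompleteSpace A] (a b : ℝ) (hab : a ≤ b) (α : ℝ → A)
    (hα : ContinuousOn α (Set.Icc a b)) :
    (Texp α a a = 1 ∧
      ∀ t ∈ Set.Icc a b,
        HasDerivWithinAt (fun u => Texp α a u) (Texp α a t * α t) (Set.Icc a b) t) ∧
    ∀ F : ℝ → A, F a = 1 →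
      (∀ t ∈ Set.Icc a b, HasDerivWithinAt F (F t * α t) (Set.Icc a b) t) →
      Set.EqOn F (fun t => Texp α a t) (Set.Icc a b) := by
  obtain ⟨M, hM⟩ := isCompact_Icc.exists_bound_of_continuousOn hα
  set β : ℝ → A := Set.IccExtend hab ((Set.Icc a b).domRestrict α) with hβ_def
  have hβ : Continuous β := hα.domRestrict.Icc_extend'
  have hβM (t : ℝ) : ‖β t‖ ≤ M := hM _ (Set.projIcc a b hab t).2
  have hαβ : Set.EqOn α β (Set.Icc a b) := fun t ht => by
    rw [hβ_def, Set.IccExtend_of_mem _ _ ht, Set.domRestrict_apply]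
  have hE : Set.EqOn (fun u => Texp α a u) (fun u => ∑' n, dysonTerm β a n u) (Set.Icc a b) :=
    fun u hu => (Texp_congr (hαβ.mono (Set.Icc_subset_Icc_right hu.2))).trans
      (Texp_eq_tsum_dysonTerm hβ hu.1)
  have hinit : Texp α a a = 1 := by
    refine (hE (Set.left_mem_Icc.2 hab)).trans ?_
    refine (tsum_eq_single 0 fun n hn => ?_).trans rfl
    obtain ⟨m, rfl⟩ := Nat.exists_eq_succ_of_ne_zero hn
    exact intervalIntegral.integral_same
  have hderiv (t : ℝ) (ht : t ∈ Set.Icc a b) :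
      HasDerivWithinAt (fun u => Texp α a u) (Texp α a t * α t) (Set.Icc a b) t := by
    have h := (hasDerivAt_tsum_dysonTerm hβ hβM a t).hasDerivWithinAt (s := Set.Icc a b)
    rw [← hαβ ht, ← show Texp α a t = ∑' n, dysonTerm β a n t from hE ht] at h
    exact h.congr hE (hE ht)
  exact ⟨⟨hinit, hderiv⟩, fun F hFa hF =>
    eqOn_of_hasDerivWithinAt_mul hM hF hderiv (hFa.trans hinit.symm)⟩
end
end

section
/- Let N ≥ 1. Every unipotent N×N matrix f with entries in the field K = ℂ({z}) of convergent Laurent series admits a Birkhoff decomposition f = (f^−)^{−1}·f^+, with f^+ unipotent with entries in O and f^− unipotent with all off-diagonal entries in Q = z^{−1}ℂ[z^{−1}], and this decomposition is unique. -/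
open MeasureTheory Filter Topology
noncomputable section

/-- A germ at `0` belonging to `K = ℂ({z})`, the field of convergent Laurent
series (germs meromorphic at `0`). -/
def MemK (f : ℂ → ℂ) : Prop := MeromorphicAt f 0

/-- A germ belonging to the subring `O ⊂ K` of germs holomorphic at `0`. -/
def MemO (f : ℂ → ℂ) : Prop :=
  ∃ g : ℂ → ℂ, AnalyticAt ℂ g 0 ∧ f =ᶠ[𝓝[≠] (0 : ℂ)] g

/-- A germ belonging to `Q = z⁻¹ ℂ[z⁻¹]`: polynomials in `z⁻¹` without
constant term. -/
def MemQ (f : ℂ → ℂ) : Prop :=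
  ∃ p : Polynomial ℂ, p.coeff 0 = 0 ∧
    ∀ᶠ z in 𝓝[≠] (0 : ℂ), f z = Polynomial.eval z⁻¹ p

/-- A matrix of germs at `0` which is unipotent (upper triangular with all
diagonal entries `1`) with entries in `K = ℂ({z})`. -/
def UnipK {N : ℕ} (F : ℂ → Matrix (Fin N) (Fin N) ℂ) : Prop :=
  (∀ i j, MeromorphicAt (fun z => F z i j) 0) ∧
  (∀ i j : Fin N, j < i → ∀ᶠ z in 𝓝[≠] (0 : ℂ), F z i j = 0) ∧
  (∀ i : Fin N, ∀ᶠ z in 𝓝[≠] (0 : ℂ), F z i i = 1)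

/-- `f⁺` part of a Birkhoff decomposition: unipotent with entries in `O`. -/
def BirkhoffPos {N : ℕ} (F : ℂ → Matrix (Fin N) (Fin N) ℂ) : Prop :=
  UnipK F ∧ ∀ i j, MemO (fun z => F z i j)

/-- `f⁻` part of a Birkhoff decomposition: unipotent with all off-diagonal
entries in `Q = z⁻¹ℂ[z⁻¹]`. -/
def BirkhoffNeg {N : ℕ} (F : ℂ → Matrix (Fin N) (Fin N) ℂ) : Prop :=
  UnipK F ∧ ∀ i j : Fin N, i ≠ j → MemQ (fun z => F z i j)

theorem MemO.sub {f g : ℂ → ℂ} (hf : MemO f) (hg : MemO g) : MemO (fun z => f z - g z) := by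
  obtain ⟨a, ha, hfa⟩ := hf
  obtain ⟨b, hb, hgb⟩ := hg
  exact ⟨fun z => a z - b z, ha.sub hb, hfa.sub hgb⟩

theorem MemO.congr {f g : ℂ → ℂ} (hf : MemO f) (h : ∀ᶠ z in 𝓝[≠] (0 : ℂ), g z = f z) :
    MemO g := by
  obtain ⟨a, ha, hfa⟩ := hf
  exact ⟨a, ha, EventuallyEq.trans h hfa⟩

theorem MemQ.sub {f g : ℂ → ℂ} (hf : MemQ f) (hg : MemQ g) : MemQ (fun z => f z - g z) := by
  obtain ⟨p, hp, hfp⟩ := hf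
  obtain ⟨q, hq, hgq⟩ := hg
  refine ⟨p - q, by simp [hp, hq], ?_⟩
  filter_upwards [hfp, hgq] with z h₁ h₂
  rw [h₁, h₂, Polynomial.eval_sub]

theorem MemQ.meromorphicAt {f : ℂ → ℂ} (hf : MemQ f) : MeromorphicAt f 0 := by
  obtain ⟨p, -, hfp⟩ := hf
  have h : MeromorphicAt (fun z : ℂ => Polynomial.eval z⁻¹ p) 0 := by
    simp only [Polynomial.eval_eq_sum_range]
    fun_prop
  exact h.congr (hfp.mono fun z hz => hz.symm)

/-- The subspaces `Q` and `O` intersect trivially. -/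
theorem MemQ.eventually_eq_zero {f : ℂ → ℂ} (hQ : MemQ f) (hO : MemO f) :
    ∀ᶠ z in 𝓝[≠] (0 : ℂ), f z = 0 := by
  obtain ⟨p, hp, hfp⟩ := hQ
  obtain ⟨g, hg, hfg⟩ := hO
  rcases lt_or_ge 0 p.degree with hdeg | hdeg
  · have hinf : Tendsto (fun z : ℂ => ‖Polynomial.eval z⁻¹ p‖) (𝓝[≠] 0) atTop :=
      p.tendsto_norm_atTop hdeg tendsto_norm_inv_nhdsNE_zero_atTop
    have hfin : Tendsto (fun z : ℂ => ‖Polynomial.eval z⁻¹ p‖) (𝓝[≠] 0) (𝓝 ‖g 0‖) := by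
      refine (hg.continuousAt.norm.tendsto.mono_left nhdsWithin_le_nhds).congr' ?_
      filter_upwards [hfp, hfg] with z h₁ h₂
      rw [← h₁, h₂]
    exact absurd hinf (not_tendsto_atTop_of_tendsto_nhds hfin)
  · rw [Polynomial.eq_C_of_degree_le_zero hdeg, hp] at hfp
    simpa using hfp

theorem exists_memQ_of_analyticAt (n : ℕ) : ∀ g : ℂ → ℂ, AnalyticAt ℂ g 0 →
    ∃ q : ℂ → ℂ, MemQ q ∧ MemO (fun z => z⁻¹ ^ n * g z - q z) := by
  induction n with
  | zero =>
    intro g hg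
    exact ⟨fun _ => 0, ⟨0, by simp, by simp⟩, g, hg, by simp⟩
  | succ n ih =>
    intro g hg
    have hslope : AnalyticAt ℂ (dslope g 0) 0 := by
      obtain ⟨p, hp⟩ := hg
      exact hp.has_fpower_series_dslope_fslope.analyticAt
    obtain ⟨q, ⟨p, hp, hqp⟩, hO⟩ := ih _ hslope
    refine ⟨fun z => q z + g 0 * z⁻¹ ^ (n + 1),
      ⟨p + Polynomial.C (g 0) * Polynomial.X ^ (n + 1), by simp [hp], ?_⟩, hO.congr ?_⟩
    · filter_upwards [hqp] with z hz
      simp [hz]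
    · filter_upwards [self_mem_nhdsWithin] with z hz
      have hz : z ≠ 0 := hz
      rw [dslope_of_ne _ hz, slope_def_field, inv_pow, inv_pow, sub_zero]
      field_simp
      ring

/-- Every element of `K` is the sum of an element of `Q` and an element of `O`. -/
theorem exists_memQ_memO_sub {f : ℂ → ℂ} (hf : MeromorphicAt f 0) :
    ∃ q : ℂ → ℂ, MemQ q ∧ MemO (fun z => f z - q z) := by
  obtain ⟨n, hn⟩ := hf
  obtain ⟨q, hq, hO⟩ := exists_memQ_of_analyticAt n _ hn
  refine ⟨q, hq, hO.congr ?_⟩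
  filter_upwards [self_mem_nhdsWithin] with z hz
  have hz : z ≠ 0 := hz
  simp [hz]

open Classical in
/-- The principal part at `0` of a meromorphic germ, with value `0` for other functions. -/
def principalPart (f : ℂ → ℂ) : ℂ → ℂ :=
  if hf : MeromorphicAt f 0 then (exists_memQ_memO_sub hf).choose else 0

theorem memQ_principalPart (f : ℂ → ℂ) : MemQ (principalPart f) := by
  unfold principalPart
  split_ifs with hf
  · exact (exists_memQ_memO_sub hf).choose_spec.1
  · exact ⟨0, by simp, by simp⟩

theorem memO_sub_principalPart {f : ℂ → ℂ} (hf : MeromorphicAt f 0) :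
    MemO (fun z => f z - principalPart f z) := by
  unfold principalPart
  rw [dif_pos hf]
  exact (exists_memQ_memO_sub hf).choose_spec.2

/-- The entries of `f⁻`, built column by column from `f⁻ * f = f⁺`. -/
def birkhoffNegEntry {N : ℕ} (f : ℂ → Matrix (Fin N) (Fin N) ℂ) (i j : Fin N) : ℂ → ℂ :=
  if j < i then 0 else if j = i then 1 else
    principalPart fun z => -(f z i j +
      ∑ k : Fin N, if _h : i < k ∧ k < j then birkhoffNegEntry f i k z * f z k j else 0)
termination_by j
decreasing_by exact _h.2

theorem Matrix.mul_apply_of_upper_unipotent {N : ℕ} {R : Type*} [CommRing R]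
    {A B : Matrix (Fin N) (Fin N) R} (hB : ∀ i j, j < i → B i j = 0) (hB' : ∀ i, B i i = 1)
    (i j : Fin N) : (A * B) i j = A i j + ∑ k ∈ Finset.Iio j, A i k * B k j := by
  rw [Matrix.mul_apply, ← Finset.sum_subset (Finset.subset_univ (Finset.Iic j)),
    ← Finset.Iio_insert, Finset.sum_insert (by simp), hB', mul_one]
  intro k _ hk
  rw [hB k j (by simpa using hk), mul_zero]

theorem UnipK.eventually_upper_unipotent {N : ℕ} {F : ℂ → Matrix (Fin N) (Fin N) ℂ}
    (hF : UnipK F) : ∀ᶠ z in 𝓝[≠] (0 : ℂ),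
      (∀ i j, j < i → F z i j = 0) ∧ ∀ i, F z i i = 1 := by
  refine .and ?_ (eventually_all.2 hF.2.2)
  refine eventually_all.2 fun i => eventually_all.2 fun j => ?_
  by_cases h : j < i
  · simpa [h] using hF.2.1 i j h
  · simp [h]

theorem UnipK.mul {N : ℕ} {F G : ℂ → Matrix (Fin N) (Fin N) ℂ} (hF : UnipK F) (hG : UnipK G) :
    UnipK (fun z => F z * G z) := by
  refine ⟨fun i j => ?_, fun i j hij => ?_, fun i => ?_⟩
  · simp only [Matrix.mul_apply]
    have h₁ := hF.1
    have h₂ := hG.1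
    fun_prop
  · filter_upwards [hF.eventually_upper_unipotent, hG.eventually_upper_unipotent] with z h₁ h₂
    rw [Matrix.mul_apply_of_upper_unipotent h₂.1 h₂.2, h₁.1 i j hij, Finset.sum_eq_zero, add_zero]
    intro k hk
    rw [h₁.1 i k ((Finset.mem_Iio.1 hk).trans hij), zero_mul]
  · filter_upwards [hF.eventually_upper_unipotent, hG.eventually_upper_unipotent] with z h₁ h₂
    rw [Matrix.mul_apply_of_upper_unipotent h₂.1 h₂.2, h₁.2, Finset.sum_eq_zero, add_zero]
    intro k hk
    rw [h₁.1 i k (Finset.mem_Iio.1 hk), zero_mul]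

theorem UnipK.eventually_isUnit_det {N : ℕ} {F : ℂ → Matrix (Fin N) (Fin N) ℂ} (hF : UnipK F) :
    ∀ᶠ z in 𝓝[≠] (0 : ℂ), IsUnit (F z).det := by
  filter_upwards [hF.eventually_upper_unipotent] with z h
  rw [Matrix.det_of_isUpperTriangular (fun i j hij => h.1 i j hij)]
  simp [h.2]

theorem memQ_birkhoffNegEntry {N : ℕ} (f : ℂ → Matrix (Fin N) (Fin N) ℂ) {i j : Fin N}
    (hij : i ≠ j) : MemQ (birkhoffNegEntry f i j) := by
  rw [birkhoffNegEntry, if_neg hij.symm]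
  split_ifs
  · exact ⟨0, by simp, by simp⟩
  · exact memQ_principalPart _

theorem birkhoffNeg_birkhoffNegEntry {N : ℕ} (f : ℂ → Matrix (Fin N) (Fin N) ℂ) :
    BirkhoffNeg (fun z => Matrix.of fun i j => birkhoffNegEntry f i j z) := by
  have hdiag (i : Fin N) : birkhoffNegEntry f i i = 1 := by
    rw [birkhoffNegEntry]
    simp
  refine ⟨⟨fun i j => ?_, fun i j hij => .of_forall fun z => ?_, fun i => ?_⟩,
    fun i j hij => memQ_birkhoffNegEntry f hij⟩
  · rcases eq_or_ne i j with rfl | hij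
    · simp only [Matrix.of_apply, hdiag]
      exact MeromorphicAt.const 1 0
    · exact (memQ_birkhoffNegEntry f hij).meromorphicAt
  · change birkhoffNegEntry f i j z = 0
    rw [birkhoffNegEntry, if_pos hij, Pi.zero_apply]
  · simp [hdiag]

theorem birkhoffPos_birkhoffNegEntry_mul {N : ℕ} {f : ℂ → Matrix (Fin N) (Fin N) ℂ}
    (hf : UnipK f) :
    BirkhoffPos (fun z => (Matrix.of fun i j => birkhoffNegEntry f i j z) * f z) := by
  have hneg := (birkhoffNeg_birkhoffNegEntry f).1
  have hmul := hneg.mul hf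
  refine ⟨hmul, fun i j => ?_⟩
  rcases lt_trichotomy j i with hij | rfl | hij
  · exact ⟨fun _ => 0, analyticAt_const, hmul.2.1 i j hij⟩
  · exact ⟨fun _ => 1, analyticAt_const, hmul.2.2 j⟩
  · set s : ℂ → ℂ := fun z => -(f z i j +
      ∑ k : Fin N, if i < k ∧ k < j then birkhoffNegEntry f i k z * f z k j else 0) with hs
    have hentry : birkhoffNegEntry f i j = principalPart s := by
      rw [birkhoffNegEntry, if_neg hij.not_gt, if_neg hij.ne']
      simp only [dite_eq_ite, hs]
    have hsK : MeromorphicAt s 0 := by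
      refine ((hf.1 i j).add (MeromorphicAt.fun_sum fun k _ => ?_)).neg
      split_ifs
      · exact (hneg.1 i k).mul (hf.1 k j)
      · exact MeromorphicAt.const 0 0
    have hzero : MemO fun _ => 0 := ⟨fun _ => 0, analyticAt_const, .rfl⟩
    refine (hzero.sub (memO_sub_principalPart hsK)).congr ?_
    filter_upwards [hneg.eventually_upper_unipotent, hf.eventually_upper_unipotent] with z h₁ h₂
    simp only [Matrix.of_apply] at h₁
    have hsum : ∑ k ∈ Finset.Iio j, birkhoffNegEntry f i k z * f z k j = -s z := by
      simp only [hs, neg_neg, ← Finset.sum_filter]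
      rw [← Finset.add_sum_erase (Finset.Iio j) _ (Finset.mem_Iio.2 hij), h₁.2 i, one_mul]
      congr 1
      symm
      apply Finset.sum_subset
      · intro k
        simp only [Finset.mem_filter, Finset.mem_univ, true_and, Finset.mem_erase,
          Finset.mem_Iio]
        exact fun h => ⟨h.1.ne', h.2⟩
      · intro k hk hk'
        simp only [Finset.mem_filter, Finset.mem_univ, true_and, Finset.mem_erase,
          Finset.mem_Iio, not_and'] at hk hk'
        rw [h₁.1 i k (lt_of_le_of_ne (not_lt.1 (hk' hk.2)) hk.1), zero_mul]
    rw [Matrix.mul_apply_of_upper_unipotent h₂.1 h₂.2]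
    simp only [Matrix.of_apply]
    rw [hsum, hentry]
    ring

/-- If `f⁻ * f = f⁺` and `g⁻ * f = g⁺`, then `f⁻ = g⁻`. -/
theorem BirkhoffNeg.eventually_eq {N : ℕ} {f fm fp gm gp : ℂ → Matrix (Fin N) (Fin N) ℂ}
    (hf : UnipK f) (hfm : BirkhoffNeg fm) (hfp : BirkhoffPos fp) (hgm : BirkhoffNeg gm)
    (hgp : BirkhoffPos gp) (hfe : ∀ᶠ z in 𝓝[≠] (0 : ℂ), fm z * f z = fp z)
    (hge : ∀ᶠ z in 𝓝[≠] (0 : ℂ), gm z * f z = gp z) :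
    ∀ᶠ z in 𝓝[≠] (0 : ℂ), gm z = fm z := by
  suffices h : ∀ j i, ∀ᶠ z in 𝓝[≠] (0 : ℂ), gm z i j = fm z i j by
    filter_upwards [eventually_all.2 fun j => eventually_all.2 (h j)] with z hz
    exact Matrix.ext fun i j => hz j i
  intro j
  induction j using WellFoundedLT.induction with
  | ind j ih =>
    intro i
    rcases eq_or_ne i j with rfl | hij
    · filter_upwards [hfm.1.2.2 i, hgm.1.2.2 i] with z h₁ h₂
      rw [h₁, h₂]
    · have hO : MemO fun z => gm z i j - fm z i j := by
        refine ((hgp.2 i j).sub (hfp.2 i j)).congr ?_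
        have ih' : ∀ᶠ z in 𝓝[≠] (0 : ℂ), ∀ k, k < j → gm z i k = fm z i k := by
          refine eventually_all.2 fun k => ?_
          by_cases hk : k < j
          · simpa [hk] using ih k hk i
          · simp [hk]
        filter_upwards [hf.eventually_upper_unipotent, hfe, hge, ih'] with z h h₁ h₂ h₃
        rw [← h₁, ← h₂, Matrix.mul_apply_of_upper_unipotent h.1 h.2,
          Matrix.mul_apply_of_upper_unipotent h.1 h.2,
          Finset.sum_congr rfl fun k hk => by rw [h₃ k (Finset.mem_Iio.1 hk)]]
        ring
      exact (((hgm.2 i j hij).sub (hfm.2 i j hij)).eventually_eq_zero hO).mono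
        fun z hz => sub_eq_zero.1 hz

/-- Existence and uniqueness of the Birkhoff decomposition `f = (f⁻)⁻¹·f⁺`
of a unipotent matrix over `K = ℂ({z})`. -/
theorem stmt5 {N : ℕ} (hN : 1 ≤ N) (f : ℂ → Matrix (Fin N) (Fin N) ℂ)
    (hf : UnipK f) :
    ∃ fm fp : ℂ → Matrix (Fin N) (Fin N) ℂ,
      BirkhoffNeg fm ∧ BirkhoffPos fp ∧
      (∀ᶠ z in 𝓝[≠] (0 : ℂ), f z = (fm z)⁻¹ * fp z) ∧
      ∀ gm gp : ℂ → Matrix (Fin N) (Fin N) ℂ,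
        BirkhoffNeg gm → BirkhoffPos gp →
        (∀ᶠ z in 𝓝[≠] (0 : ℂ), f z = (gm z)⁻¹ * gp z) →
        (∀ᶠ z in 𝓝[≠] (0 : ℂ), gm z = fm z ∧ gp z = fp z) := by
  have hneg := birkhoffNeg_birkhoffNegEntry f
  have hpos := birkhoffPos_birkhoffNegEntry_mul hf
  refine ⟨_, _, hneg, hpos, ?_, fun gm gp hgm hgp hg => ?_⟩
  · filter_upwards [hneg.1.eventually_isUnit_det] with z hz
    rw [Matrix.nonsing_inv_mul_cancel_left _ _ hz]
  · have hge : ∀ᶠ z in 𝓝[≠] (0 : ℂ), gm z * f z = gp z := by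
      filter_upwards [hg, hgm.1.eventually_isUnit_det] with z h₁ h₂
      rw [h₁, Matrix.mul_nonsing_inv_cancel_left _ _ h₂]
    filter_upwards [hneg.eventually_eq hf hpos hgm hgp (.of_forall fun _ => rfl) hge, hge]
      with z h₁ h₂
    exact ⟨h₁, by rw [← h₂, h₁]⟩
end
end

section
/- Fix N ≥ 1 and a diagonal matrix D = diag(d_1,…,d_N) such that d_i − d_j is a positive integer whenever i < j. Let Δ* be a punctured open disk around 0 ∈ ℂ and let a, b : Δ* → (strictly upper triangular N×N complex matrices) be holomorphic. Define the matrix-valued 1-form ω on Δ* × ℂ* by ω(z,u) = u^Y(a(z)) dz + u^Y(b(z)) du/u, where u^Y(x) = Σ_{n≥1} u^n x_n on graded components. Then ω is flat, i.e. dω + ω∧ω = 0 on Δ* × ℂ*, if and only if db/dz − Y(a) + [a,b] = 0 on Δ*, where Y(a) = [D,a] = Σ_{n≥1} n·a_n. -/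
open MeasureTheory Filter Topology
noncomputable section
attribute [local instance] Matrix.normedAddCommGroup Matrix.normedSpace

/-- The graded component `x_n` of a matrix `x`, supported on the positions
`(i,j)` with `d i − d j = n`, for `D = diag d`. -/
def gpart {N : ℕ} (d : Fin N → ℂ) (n : ℕ) (x : Matrix (Fin N) (Fin N) ℂ) :
    Matrix (Fin N) (Fin N) ℂ :=
  Matrix.of fun i j => if d i - d j = (n : ℂ) then x i j else 0

/-- `u^Y(x) = Σ_n u^n x_n` (graded components with respect to `D = diag d`). -/
def uY {N : ℕ} (d : Fin N → ℂ) (u : ℂ) (x : Matrix (Fin N) (Fin N) ℂ) :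
    Matrix (Fin N) (Fin N) ℂ :=
  ∑' n : ℕ, u ^ n • gpart d n x

/-- `u^Y(x)/u = Σ_{n≥1} u^{n−1} x_n`, which is entire in `u`. -/
def uYdiv {N : ℕ} (d : Fin N → ℂ) (u : ℂ) (x : Matrix (Fin N) (Fin N) ℂ) :
    Matrix (Fin N) (Fin N) ℂ :=
  ∑' n : ℕ, u ^ n • gpart d (n + 1) x

/-- `Y(x) = [D,x] = Σ_{n≥1} n·x_n`. -/
def Yop {N : ℕ} (d : Fin N → ℂ) (x : Matrix (Fin N) (Fin N) ℂ) :
    Matrix (Fin N) (Fin N) ℂ :=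
  ∑' n : ℕ, (n : ℂ) • gpart d n x

/-- A strictly upper triangular matrix. -/
def SUT {N : ℕ} (x : Matrix (Fin N) (Fin N) ℂ) : Prop :=
  ∀ i j : Fin N, ¬ i < j → x i j = 0

/-- The derivative of a matrix-valued function, taken entrywise. -/
def matDeriv {N : ℕ} (h : ℂ → Matrix (Fin N) (Fin N) ℂ) (z : ℂ) :
    Matrix (Fin N) (Fin N) ℂ :=
  Matrix.of fun i j => deriv (fun w => h w i j) z

/-- A weighted sum of graded components of a strictly upper triangular matrix, entrywise. -/
theorem tsum_smul_gpart {N : ℕ} {d : Fin N → ℂ} {m : Fin N → Fin N → ℕ}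
    (hm : ∀ i j, i < j → 0 < m i j ∧ d i - d j = (m i j : ℂ)) {k : ℕ} (hk : k ≤ 1)
    (c : ℕ → ℂ) {x : Matrix (Fin N) (Fin N) ℂ} (hx : SUT x) :
    ∑' n : ℕ, c n • gpart d (n + k) x = Matrix.of fun i j => c (m i j - k) * x i j := by
  refine HasSum.tsum_eq (Pi.hasSum.2 fun i => Pi.hasSum.2 fun j => ?_)
  by_cases hij : i < j
  · obtain ⟨hpos, hdm⟩ := hm i j hij
    convert hasSum_single (m i j - k) fun n hn => ?_ using 1
    · have hmk : m i j - k + k = m i j := by omega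
      simp [gpart, hmk, hdm]
    · have hne : m i j ≠ n + k := by omega
      have hne' : ((m i j : ℕ) : ℂ) ≠ ((n + k : ℕ) : ℂ) := by exact_mod_cast hne
      simp only [Matrix.smul_apply, gpart, Matrix.of_apply, hdm, if_neg hne', smul_zero]
  · simp [gpart, hx i j hij, hasSum_zero]

theorem uY_eq_of_SUT {N : ℕ} {d : Fin N → ℂ} {m : Fin N → Fin N → ℕ}
    (hm : ∀ i j, i < j → 0 < m i j ∧ d i - d j = (m i j : ℂ)) (u : ℂ)
    {x : Matrix (Fin N) (Fin N) ℂ} (hx : SUT x) :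
    uY d u x = Matrix.of fun i j => u ^ m i j * x i j :=
  tsum_smul_gpart hm (Nat.zero_le 1) (fun n => u ^ n) hx

theorem uYdiv_eq_of_SUT {N : ℕ} {d : Fin N → ℂ} {m : Fin N → Fin N → ℕ}
    (hm : ∀ i j, i < j → 0 < m i j ∧ d i - d j = (m i j : ℂ)) (u : ℂ)
    {x : Matrix (Fin N) (Fin N) ℂ} (hx : SUT x) :
    uYdiv d u x = Matrix.of fun i j => u ^ (m i j - 1) * x i j :=
  tsum_smul_gpart hm le_rfl (fun n => u ^ n) hx

theorem Yop_eq_of_SUT {N : ℕ} {d : Fin N → ℂ} {m : Fin N → Fin N → ℕ}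
    (hm : ∀ i j, i < j → 0 < m i j ∧ d i - d j = (m i j : ℂ))
    {x : Matrix (Fin N) (Fin N) ℂ} (hx : SUT x) :
    Yop d x = Matrix.of fun i j => (m i j : ℂ) * x i j :=
  tsum_smul_gpart hm (Nat.zero_le 1) (fun n => (n : ℂ)) hx

/-- The curvature at `(z, u)` is, entry by entry, a power of `u` times
`db/dz − Y(a) + [a,b]` at `z`. -/
theorem curvature_apply {N : ℕ} {d : Fin N → ℂ} {m : Fin N → Fin N → ℕ}
    (hm : ∀ i j, i < j → 0 < m i j ∧ d i - d j = (m i j : ℂ))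
    {b : ℂ → Matrix (Fin N) (Fin N) ℂ} {A : Matrix (Fin N) (Fin N) ℂ} {z : ℂ}
    (hA : SUT A) (hb : ∀ᶠ w in 𝓝 z, SUT (b w)) (u : ℂ) (i j : Fin N) :
    (matDeriv (fun w => uYdiv d u (b w)) z -
        (Matrix.of fun i j => deriv (fun w => uY d w A i j) u) +
        (uY d u A * uYdiv d u (b z) - uYdiv d u (b z) * uY d u A)) i j =
      u ^ (m i j - 1) * (matDeriv b z - Yop d A + (A * b z - b z * A)) i j := by
  have hbz : SUT (b z) := hb.self_of_nhds
  have hadd : ∀ k, i < k → k < j → m i j = m i k + m k j := fun k hik hkj => by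
    have h : ((m i j : ℕ) : ℂ) = ((m i k + m k j : ℕ) : ℂ) := by
      push_cast
      rw [← (hm i j (hik.trans hkj)).2, ← (hm i k hik).2, ← (hm k j hkj).2]
      ring
    exact_mod_cast h
  have hderiv : deriv (fun w => uYdiv d u (b w) i j) z =
      u ^ (m i j - 1) * deriv (fun w => b w i j) z := by
    rw [← deriv_const_mul_field]
    refine Filter.EventuallyEq.deriv_eq (hb.mono fun w hw => ?_)
    simp [uYdiv_eq_of_SUT hm u hw]
  have hab : (uY d u A * uYdiv d u (b z)) i j = u ^ (m i j - 1) * (A * b z) i j := by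
    rw [uY_eq_of_SUT hm u hA, uYdiv_eq_of_SUT hm u hbz, Matrix.mul_apply, Matrix.mul_apply,
      Finset.mul_sum]
    refine Finset.sum_congr rfl fun k _ => ?_
    by_cases hik : i < k
    · by_cases hkj : k < j
      · have hpos := (hm k j hkj).1
        rw [show m i j - 1 = m i k + (m k j - 1) by have := hadd k hik hkj; omega, pow_add]
        simp only [Matrix.of_apply]
        ring
      · simp [hbz k j hkj]
    · simp [hA i k hik]
  have hba : (uYdiv d u (b z) * uY d u A) i j = u ^ (m i j - 1) * (b z * A) i j := by
    rw [uY_eq_of_SUT hm u hA, uYdiv_eq_of_SUT hm u hbz, Matrix.mul_apply, Matrix.mul_apply,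
      Finset.mul_sum]
    refine Finset.sum_congr rfl fun k _ => ?_
    by_cases hik : i < k
    · by_cases hkj : k < j
      · have hpos := (hm i k hik).1
        rw [show m i j - 1 = m i k - 1 + m k j by have := hadd k hik hkj; omega, pow_add]
        simp only [Matrix.of_apply]
        ring
      · simp [hA k j hkj]
    · simp [hbz i k hik]
  have hu : deriv (fun w => uY d w A i j) u = m i j * u ^ (m i j - 1) * A i j := by
    simp [uY_eq_of_SUT hm _ hA]
  simp only [Matrix.add_apply, Matrix.sub_apply, hab, hba, Yop_eq_of_SUT hm hA]
  simp only [matDeriv, Matrix.of_apply, hderiv, hu]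
  ring

/-- The connection form `ω(z,u) = u^Y(a(z)) dz + u^Y(b(z)) du/u` on `Δ* × ℂ*`
is flat, `dω + ω∧ω = 0`, iff `db/dz − Y(a) + [a,b] = 0` on `Δ*`. -/
theorem stmt9 {N : ℕ} (hN : 1 ≤ N) (d : Fin N → ℂ)
    (hd : ∀ i j : Fin N, i < j → ∃ n : ℕ, 0 < n ∧ d i - d j = (n : ℂ))
    (r : ℝ) (hr : 0 < r) (a b : ℂ → Matrix (Fin N) (Fin N) ℂ)
    (ha : ∀ z ∈ Metric.ball (0 : ℂ) r \ {0}, ∀ i j,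
      DifferentiableAt ℂ (fun w => a w i j) z)
    (hb : ∀ z ∈ Metric.ball (0 : ℂ) r \ {0}, ∀ i j,
      DifferentiableAt ℂ (fun w => b w i j) z)
    (hsa : ∀ z ∈ Metric.ball (0 : ℂ) r \ {0}, SUT (a z))
    (hsb : ∀ z ∈ Metric.ball (0 : ℂ) r \ {0}, SUT (b z)) :
    (∀ z ∈ Metric.ball (0 : ℂ) r \ {0}, ∀ u : ℂ, u ≠ 0 →
      matDeriv (fun w => uYdiv d u (b w)) z -
        (Matrix.of fun i j => deriv (fun w => uY d w (a z) i j) u) +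
        (uY d u (a z) * uYdiv d u (b z) - uYdiv d u (b z) * uY d u (a z)) = 0) ↔
    (∀ z ∈ Metric.ball (0 : ℂ) r \ {0},
      matDeriv b z - Yop d (a z) + (a z * b z - b z * a z) = 0) := by
  have hex : ∀ i j : Fin N, ∃ n : ℕ, i < j → 0 < n ∧ d i - d j = (n : ℂ) := fun i j => by
    by_cases hij : i < j
    · obtain ⟨n, hn⟩ := hd i j hij
      exact ⟨n, fun _ => hn⟩
    · exact ⟨0, fun h => absurd h hij⟩
  choose m hm using hex
  have hopen : IsOpen (Metric.ball (0 : ℂ) r \ {0}) :=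
    Metric.isOpen_ball.sdiff isClosed_singleton
  have key := fun z hz => curvature_apply hm (hsa z hz)
    (Filter.eventually_of_mem (hopen.mem_nhds hz) hsb)
  refine forall₂_congr fun z hz => ⟨fun h => ?_, fun h u _ => ?_⟩
  · ext i j
    have hij := key z hz 1 i j
    rw [h 1 one_ne_zero, one_pow, one_mul] at hij
    exact hij.symm
  · ext i j
    rw [key z hz u i j, h, Matrix.zero_apply, mul_zero]
end
end

section
/- Fix N ≥ 1 and a diagonal matrix D = diag(d_1,…,d_N) such that d_i − d_j is a positive integer whenever i < j. For a strictly upper triangular complex matrix β with graded components β_n, write Te^{−(1/z)∫_0^1 u^Y(β) du/u} = 1 + Σ_{n≥1} c_n(β) z^{−n} (a finite sum since β is nilpotent). Then c_1(β) = −Σ_{n≥1} β_n/n. Consequently the map β ↦ γ_β^−, where γ_β^−(z)^{−1} = Te^{−(1/z)∫_0^1 u^Y(β) du/u}, is injective on strictly upper triangular matrices: if γ_β^−(z) = γ_{β'}^−(z) for all z ≠ 0 then β = β'. -/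
open MeasureTheory Filter Topology
noncomputable section
attribute [local instance] Matrix.normedAddCommGroup Matrix.normedSpace

/-- `Te^{−(1/z)∫_{c₀}^{c₁} u^Y(β) du/u}`: the time-ordered exponential of the
1-form `−(1/z)·Σ_{n≥1} u^{n−1} β_n du` along the straight path from `c₀` to
`c₁` (pullback `t ↦ −(1/z)(c₁−c₀)·Σ_{n≥1} (c₀+t(c₁−c₀))^{n−1} β_n`). -/
def TexpPath {N : ℕ} (d : Fin N → ℂ) (β : Matrix (Fin N) (Fin N) ℂ)
    (z c₀ c₁ : ℂ) : Matrix (Fin N) (Fin N) ℂ :=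
  ∑' n : ℕ, ∫ s in orderedSimplex n 0 1,
    (List.ofFn fun i : Fin n =>
      (-z⁻¹ * (c₁ - c₀)) • uYdiv d (c₀ + (s i : ℂ) * (c₁ - c₀)) β).prod

/-- The coefficient `c_n(β)` in the expansion
`Te^{−(1/z)∫_0^1 u^Y(β) du/u} = 1 + Σ_{n≥1} c_n(β) z^{−n}`, namely
`c_n(β) = (−1)^n ∫_{0≤s_1≤⋯≤s_n≤1} Π_i (Σ_k s_i^{k−1} β_k) ds`. -/
def cCoef {N : ℕ} (d : Fin N → ℂ) (β : Matrix (Fin N) (Fin N) ℂ) (n : ℕ) :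
    Matrix (Fin N) (Fin N) ℂ :=
  ((-1 : ℂ)) ^ n • ∫ s in orderedSimplex n 0 1,
    (List.ofFn fun i : Fin n => uYdiv d (s i : ℂ) β).prod

theorem exists_gpart_eq_zero {N : ℕ} (d : Fin N → ℂ) :
    ∃ M : ℕ, (∀ i j, ∀ m : ℕ, d i - d j = (m : ℂ) → m < M) ∧
      ∀ x : Matrix (Fin N) (Fin N) ℂ, ∀ n ∉ Finset.range M, gpart d (n + 1) x = 0 := by
  obtain ⟨M, hM⟩ : ∃ M : ℕ, ∀ i j, ∀ m : ℕ, d i - d j = (m : ℂ) → m < M := by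
    obtain ⟨B, hB⟩ := (Set.finite_range fun p : Fin N × Fin N => ‖d p.1 - d p.2‖).bddAbove
    obtain ⟨M, hM⟩ := exists_nat_gt B
    refine ⟨M, fun i j m h => ?_⟩
    have h1 : ‖d i - d j‖ ≤ B := hB ⟨(i, j), rfl⟩
    rw [h, Complex.norm_natCast] at h1
    exact_mod_cast h1.trans_lt hM
  refine ⟨M, hM, fun x n hn => ?_⟩
  ext i j
  simp only [gpart, Matrix.of_apply, Matrix.zero_apply, ite_eq_right_iff]
  intro h
  have := hM i j _ h
  simp at hn
  omega

/-- The product of `n` strictly upper triangular matrices vanishes below the `n`-th diagonal. -/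
theorem prod_ofFn_apply_eq_zero {N n : ℕ} (f : Fin n → Matrix (Fin N) (Fin N) ℂ)
    (hf : ∀ k, SUT (f k)) (i j : Fin N) (hij : (j : ℕ) < i + n) :
    (List.ofFn f).prod i j = 0 := by
  induction n generalizing i with
  | zero =>
    have : i ≠ j := fun h => by simp [h] at hij
    simp [Matrix.one_apply_ne this]
  | succ n ih =>
    rw [List.ofFn_succ, List.prod_cons, Matrix.mul_apply]
    refine Finset.sum_eq_zero fun k _ => ?_
    by_cases h : i < k
    · rw [ih _ (fun k => hf _) k (by have : (i : ℕ) < k := h; omega), mul_zero]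
    · rw [hf 0 i k h, zero_mul]

theorem SUT.uYdiv {N : ℕ} (d : Fin N → ℂ) {β : Matrix (Fin N) (Fin N) ℂ} (hβ : SUT β) (u : ℂ) :
    SUT (uYdiv d u β) := by
  intro i j hij
  obtain ⟨M, -, hM⟩ := exists_gpart_eq_zero d
  rw [_root_.uYdiv, tsum_eq_sum fun n hn => by rw [hM β n hn, smul_zero], Matrix.sum_apply]
  exact Finset.sum_eq_zero fun n _ => by simp [gpart, hβ i j hij]

theorem LinearMap.integral_eq_zero {α E : Type*} [MeasurableSpace α] {μ : Measure α}
    [NormedAddCommGroup E] [NormedSpace ℂ E] [FiniteDimensional ℂ E] (L : E →ₗ[ℂ] ℂ) {f : α → E}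
    (h : ∀ a, L (f a) = 0) : L (∫ a, f a ∂μ) = 0 := by
  have := FiniteDimensional.complete ℂ E
  by_cases hf : Integrable f μ
  · have h1 := (LinearMap.toContinuousLinearMap L).integral_comp_comm hf
    simpa [h] using h1.symm
  · rw [integral_undef hf, map_zero]

theorem cCoef_apply_eq_zero {N : ℕ} (d : Fin N → ℂ) {β : Matrix (Fin N) (Fin N) ℂ} (hβ : SUT β)
    (n : ℕ) (i j : Fin N) (hij : (j : ℕ) < i + n) : cCoef d β n i j = 0 := by
  have h := LinearMap.integral_eq_zero (Matrix.entryLinearMap ℂ ℂ i j)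
    (μ := volume.restrict (orderedSimplex n 0 1))
    (f := fun s => (List.ofFn fun k : Fin n => uYdiv d (s k : ℂ) β).prod)
    fun s => prod_ofFn_apply_eq_zero _ (fun k => hβ.uYdiv d _) i j hij
  rw [Matrix.entryLinearMap_apply] at h
  rw [cCoef, Matrix.smul_apply, h, smul_zero]

theorem cCoef_zero {N : ℕ} (d : Fin N → ℂ) (β : Matrix (Fin N) (Fin N) ℂ) : cCoef d β 0 = 1 := by
  have : orderedSimplex 0 0 1 = Set.univ :=
    Set.eq_univ_of_forall fun s => ⟨fun i => i.elim0, fun i => i.elim0⟩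
  have hvol : (volume : Measure (Fin 0 → ℝ)) = Measure.dirac 0 := by
    rw [volume_pi, Measure.pi_of_empty _ 0]
  simp [cCoef, this, hvol]

theorem List.prod_ofFn_smul {R A : Type*} [CommSemiring R] [Semiring A] [Algebra R A] (c : R)
    {n : ℕ} (f : Fin n → A) :
    (List.ofFn fun k => c • f k).prod = c ^ n • (List.ofFn f).prod := by
  induction n with
  | zero => simp
  | succ n ih =>
    rw [List.ofFn_succ, List.prod_cons, ih, List.ofFn_succ, List.prod_cons, smul_mul_smul_comm,
      pow_succ']

theorem TexpPath_eq_sum {N : ℕ} (d : Fin N → ℂ) {β : Matrix (Fin N) (Fin N) ℂ} (hβ : SUT β)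
    (z : ℂ) :
    TexpPath d β z 0 1 = 1 + ∑ n ∈ Finset.Icc 1 N, (z⁻¹) ^ n • cCoef d β n := by
  have hterm : ∀ n : ℕ, (∫ s in orderedSimplex n 0 1, (List.ofFn fun i : Fin n =>
      (-z⁻¹ * (1 - 0)) • uYdiv d (0 + (s i : ℂ) * (1 - 0)) β).prod) = (z⁻¹) ^ n • cCoef d β n := by
    intro n
    simp only [List.prod_ofFn_smul, sub_zero, mul_one, zero_add]
    rw [integral_smul, cCoef, smul_smul, ← mul_pow, mul_neg_one]
  rw [TexpPath, tsum_congr hterm, tsum_eq_sum (s := Finset.range (N + 1)), Finset.sum_range_succ']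
  · rw [pow_zero, one_smul, cCoef_zero, add_comm, Finset.range_eq_Ico,
      Finset.sum_Ico_add' (fun n => (z⁻¹) ^ n • cCoef d β n) 0 N 1]
    rfl
  · intro n hn
    have : cCoef d β n = 0 := by
      ext i j
      refine cCoef_apply_eq_zero d hβ n i j ?_
      simp at hn
      omega
    rw [this, smul_zero]

theorem det_TexpPath {N : ℕ} (d : Fin N → ℂ) {β : Matrix (Fin N) (Fin N) ℂ} (hβ : SUT β) (z : ℂ) :
    (TexpPath d β z 0 1).det = 1 := by
  have hS : ∀ i j : Fin N, ¬ i < j →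
      (∑ n ∈ Finset.Icc 1 N, (z⁻¹) ^ n • cCoef d β n) i j = 0 := by
    intro i j hij
    rw [Matrix.sum_apply]
    refine Finset.sum_eq_zero fun n hn => ?_
    rw [Matrix.smul_apply, cCoef_apply_eq_zero d hβ, smul_zero]
    have : 1 ≤ n := (Finset.mem_Icc.1 hn).1
    have : (j : ℕ) ≤ i := not_lt.1 hij
    omega
  rw [TexpPath_eq_sum d hβ, Matrix.det_of_isUpperTriangular]
  · exact Finset.prod_eq_one fun i _ => by
      rw [Matrix.add_apply, hS i i (lt_irrefl i), Matrix.one_apply_eq, add_zero]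
  · intro i j hij
    have hij : j < i := hij
    rw [Matrix.add_apply, hS i j hij.not_gt, Matrix.one_apply_ne hij.ne', add_zero]

theorem cCoef_one {N : ℕ} (d : Fin N → ℂ) (β : Matrix (Fin N) (Fin N) ℂ) :
    cCoef d β 1 = -(∑' n : ℕ, (((n : ℂ) + 1)⁻¹) • gpart d (n + 1) β) := by
  obtain ⟨M, -, hM⟩ := exists_gpart_eq_zero d
  have hset : orderedSimplex 1 0 1 =
      MeasurableEquiv.funUnique (Fin 1) ℝ ⁻¹' Set.Icc (0 : ℝ) 1 := by
    ext s
    simp [orderedSimplex, Subsingleton.monotone]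
  have hint : ∫ s in orderedSimplex 1 0 1, (List.ofFn fun i : Fin 1 => uYdiv d (s i : ℂ) β).prod
      = ∫ t in Set.Icc (0 : ℝ) 1, uYdiv d (t : ℂ) β := by
    rw [hset, ← (volume_preserving_funUnique (Fin 1) ℝ).setIntegral_preimage_emb
      (MeasurableEquiv.measurableEmbedding _)]
    simp only [List.ofFn_succ, List.ofFn_zero, List.prod_singleton]
    rfl
  have hpow : ∀ n : ℕ, ∫ t in Set.Icc (0 : ℝ) 1, (t : ℂ) ^ n = ((n : ℂ) + 1)⁻¹ := by
    intro n
    rw [integral_Icc_eq_integral_Ioc, ← intervalIntegral.integral_of_le zero_le_one]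
    simp only [← Complex.ofReal_pow]
    rw [intervalIntegral.integral_ofReal, integral_pow]
    simp
  have hu : ∀ u : ℂ, uYdiv d u β = ∑ n ∈ Finset.range M, u ^ n • gpart d (n + 1) β := fun u =>
    tsum_eq_sum fun n hn => by rw [hM β n hn, smul_zero]
  rw [cCoef, hint, pow_one, neg_one_smul, tsum_eq_sum fun n hn => by rw [hM β n hn, smul_zero]]
  simp only [hu]
  rw [integral_finsetSum]
  · simp only [integral_smul_const, hpow]
  · intro n _
    refine ContinuousOn.integrableOn_Icc ?_
    fun_prop

theorem cCoef_one_apply {N : ℕ} (d : Fin N → ℂ) (β : Matrix (Fin N) (Fin N) ℂ) {i j : Fin N}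
    {n : ℕ} (hn : 0 < n) (h : d i - d j = (n : ℂ)) : cCoef d β 1 i j = -((n : ℂ)⁻¹ * β i j) := by
  obtain ⟨M, hdM, hM⟩ := exists_gpart_eq_zero d
  obtain ⟨m, rfl⟩ : ∃ m, n = m + 1 := ⟨n - 1, by omega⟩
  rw [cCoef_one, tsum_eq_sum fun n hn => by rw [hM β n hn, smul_zero], Matrix.neg_apply,
    Matrix.sum_apply, Finset.sum_eq_single m]
  · simp [gpart, h]
  · intro k _ hk
    have : ((m + 1 : ℕ) : ℂ) ≠ ((k + 1 : ℕ) : ℂ) := by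
      simpa using hk.symm
    simp only [Matrix.smul_apply, gpart, Matrix.of_apply, h, if_neg this, smul_zero]
  · intro hm
    have := hdM i j _ h
    simp at hm
    omega

theorem cCoef_one_eq_of_TexpPath_eq {N : ℕ} (hN : 1 ≤ N) (d : Fin N → ℂ)
    {β β' : Matrix (Fin N) (Fin N) ℂ} (hβ : SUT β) (hβ' : SUT β')
    (h : ∀ z : ℂ, z ≠ 0 → TexpPath d β z 0 1 = TexpPath d β' z 0 1) :
    cCoef d β 1 = cCoef d β' 1 := by
  ext i j
  let p : Polynomial ℂ := ∑ n ∈ Finset.Icc 1 N,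
    Polynomial.C (cCoef d β n i j - cCoef d β' n i j) * Polynomial.X ^ n
  have hp : p = 0 := by
    refine Polynomial.eq_zero_of_infinite_isRoot p
      ((Set.finite_singleton (0 : ℂ)).infinite_compl.mono fun w hw => ?_)
    have h1 := congrFun (congrFun (h w⁻¹ (inv_ne_zero hw)) i) j
    rw [TexpPath_eq_sum d hβ, TexpPath_eq_sum d hβ', Matrix.add_apply, Matrix.add_apply,
      add_right_inj, Matrix.sum_apply, Matrix.sum_apply, ← sub_eq_zero,
      ← Finset.sum_sub_distrib] at h1
    simp only [Set.mem_ofPred_eq, Polynomial.IsRoot.def, p, Polynomial.eval_finsetSum]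
    rw [← h1]
    refine Finset.sum_congr rfl fun n _ => ?_
    simp
    ring
  have hc : p.coeff 1 = cCoef d β 1 i j - cCoef d β' 1 i j := by
    simp only [p, Polynomial.finsetSum_coeff, Polynomial.coeff_C_mul_X_pow]
    rw [Finset.sum_ite_eq, if_pos (Finset.mem_Icc.2 ⟨le_rfl, hN⟩)]
  rw [hp, Polynomial.coeff_zero] at hc
  exact sub_eq_zero.1 hc.symm

/-- `Te^{−(1/z)∫_0^1 u^Y(β) du/u} = 1 + Σ_{n≥1} c_n(β) z^{−n}` is a finite sum
(as `β` is nilpotent), `c_1(β) = −Σ_{n≥1} β_n/n`, and consequently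
`β ↦ γ_β^−` (with `γ_β^−(z)⁻¹ = Te^{−(1/z)∫_0^1 u^Y(β) du/u}`) is injective on
strictly upper triangular matrices. -/
theorem stmt13 {N : ℕ} (hN : 1 ≤ N) (d : Fin N → ℂ)
    (hd : ∀ i j : Fin N, i < j → ∃ n : ℕ, 0 < n ∧ d i - d j = (n : ℂ)) :
    (∀ β : Matrix (Fin N) (Fin N) ℂ, SUT β → ∀ z : ℂ, z ≠ 0 →
      TexpPath d β z 0 1 = 1 + ∑ n ∈ Finset.Icc 1 N, (z⁻¹) ^ n • cCoef d β n) ∧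
    (∀ β : Matrix (Fin N) (Fin N) ℂ, SUT β →
      cCoef d β 1 = -(∑' n : ℕ, (((n : ℂ) + 1)⁻¹) • gpart d (n + 1) β)) ∧
    (∀ β β' : Matrix (Fin N) (Fin N) ℂ, SUT β → SUT β' →
      (∀ z : ℂ, z ≠ 0 → (TexpPath d β z 0 1)⁻¹ = (TexpPath d β' z 0 1)⁻¹) →
      β = β') := by
  refine ⟨fun β hβ z _ => TexpPath_eq_sum d hβ z, fun β _ => cCoef_one d β,
    fun β β' hβ hβ' h => ?_⟩
  have hT : ∀ z : ℂ, z ≠ 0 → TexpPath d β z 0 1 = TexpPath d β' z 0 1 := fun z hz =>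
    Matrix.inv_inj (h z hz) (by rw [det_TexpPath d hβ]; exact isUnit_one)
  ext i j
  by_cases hij : i < j
  · obtain ⟨n, hn, hdn⟩ := hd i j hij
    have h1 := congrFun (congrFun (cCoef_one_eq_of_TexpPath_eq hN d hβ hβ' hT) i) j
    rw [cCoef_one_apply d β hn hdn, cCoef_one_apply d β' hn hdn] at h1
    exact mul_left_cancel₀ (inv_ne_zero (Nat.cast_ne_zero.2 hn.ne')) (neg_injective h1)
  · rw [hβ i j hij, hβ' i j hij]
end
end
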